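/- For every finite meet-semilattice S with least element 0 and greatest element 1 of order n ≥ 3, and every m ≥ 1, the number of inconsistent equations in at most m variables over S is at most (2^m − 1)·(n² − 3n + 3). -/

import Mathlib

/-- An equation of the first kind in at most `m` variables over a meet-semilattice `S`:
`(⊓_{i ∈ T} x_i) ⊓ s₁ = (⊓_{i ∈ U} x_i) ⊓ s₂` with `T, U` nonempty. -/
structure EqFst (S : Type*) (m : ℕ) where
  T : Finset (Fin m)
  hT : T.Nonempty
  s₁ : S
  U : Finset (Fin m)
  hU : U.Nonempty
  s₂ : S

/-- An equation of the second kind: `(⊓_{i ∈ T} x_i) ⊓ s₁ = s₂` with `T` nonempty. -/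
structure EqSnd (S : Type*) (m : ℕ) where
  T : Finset (Fin m)
  hT : T.Nonempty
  s₁ : S
  s₂ : S

def EqFst.HasSolution {S : Type*} [SemilatticeInf S] {m : ℕ} (e : EqFst S m) : Prop :=
  ∃ v : Fin m → S, (e.T.inf' e.hT v) ⊓ e.s₁ = (e.U.inf' e.hU v) ⊓ e.s₂

def EqSnd.HasSolution {S : Type*} [SemilatticeInf S] {m : ℕ} (e : EqSnd S m) : Prop :=
  ∃ v : Fin m → S, (e.T.inf' e.hT v) ⊓ e.s₁ = e.s₂

/-- The number of inconsistent equations (of both kinds) in at most `m` variables over `S`. -/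
noncomputable def numInconsistent (S : Type*) [SemilatticeInf S] (m : ℕ) : ℕ :=
  Nat.card {e : EqFst S m // ¬ e.HasSolution} + Nat.card {e : EqSnd S m // ¬ e.HasSolution}

/-- Assigning `⊥` to every variable solves every equation of the first kind. -/
theorem EqFst.hasSolution {S : Type*} [SemilatticeInf S] [OrderBot S] {m : ℕ} (e : EqFst S m) :
    e.HasSolution :=
  ⟨fun _ => ⊥, by simp [Finset.inf'_const]⟩

theorem EqSnd.hasSolution_of_le {S : Type*} [SemilatticeInf S] {m : ℕ} {e : EqSnd S m}
    (h : e.s₂ ≤ e.s₁) : e.HasSolution :=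
  ⟨fun _ => e.s₂, by simpa [Finset.inf'_const] using h⟩

theorem card_finset_nonempty (m : ℕ) :
    Nat.card {T : Finset (Fin m) // T.Nonempty} = 2 ^ m - 1 := by
  classical
  simp_rw [Finset.nonempty_iff_ne_empty]
  rw [Nat.card_eq_fintype_card, Fintype.card_subtype_compl]
  simp

theorem card_not_le_le {S : Type*} [Fintype S] [PartialOrder S] [OrderBot S] [OrderTop S]
    (hn : 3 ≤ Fintype.card S) :
    Nat.card {p : S × S // ¬ p.2 ≤ p.1} ≤ Fintype.card S ^ 2 - 3 * Fintype.card S + 3 := by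
  classical
  have : Nontrivial S := Fintype.one_lt_card_iff_nontrivial.1 (by omega)
  have hne : (⊤ : S) ≠ ⊥ := by
    intro h
    obtain ⟨a, ha⟩ := exists_ne (⊥ : S)
    exact ha (le_bot_iff.1 (h ▸ le_top))
  let A : Finset S := Finset.univ.erase ⊤
  let B : Finset S := Finset.univ.erase ⊥
  let D : Finset (S × S) := (A ∩ B).image fun a => (a, a)
  have hsub : (Finset.univ.filter fun p : S × S => ¬ p.2 ≤ p.1) ⊆ (A ×ˢ B) \ D := by
    rintro ⟨a, b⟩ h
    have h : ¬ b ≤ a := by simpa using h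
    have ha : a ≠ ⊤ := by rintro rfl; exact h le_top
    have hb : b ≠ ⊥ := by rintro rfl; exact h bot_le
    have hab : a ≠ b := by rintro rfl; exact h le_rfl
    simp only [A, B, D, Finset.mem_sdiff, Finset.mem_product, Finset.mem_image, Prod.mk.injEq]
    refine ⟨by simp [ha, hb], ?_⟩
    rintro ⟨c, -, rfl, rfl⟩
    exact hab rfl
  have hD : D ⊆ A ×ˢ B := by
    intro p hp
    obtain ⟨a, ha, rfl⟩ := Finset.mem_image.1 hp
    simpa using ha
  have hA : A.card = Fintype.card S - 1 := by simp [A]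
  have hB : B.card = Fintype.card S - 1 := by simp [B]
  have hAB : A ∩ B = B.erase ⊤ := by ext; simp [A, B]
  have hDc : D.card = Fintype.card S - 2 := by
    rw [Finset.card_image_of_injective _ fun a b h => congrArg Prod.fst h, hAB,
      Finset.card_erase_of_mem (by simpa [B] using hne), hB]
    omega
  rw [Nat.card_eq_fintype_card, Fintype.card_subtype]
  refine (Finset.card_le_card hsub).trans ?_
  rw [Finset.card_sdiff_of_subset hD, Finset.card_product, hA, hB, hDc]
  obtain ⟨k, hk⟩ := Nat.exists_eq_add_of_le hn
  rw [hk]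
  have h₁ : (3 + k - 1) * (3 + k - 1) = k ^ 2 + 4 * k + 4 := by
    rw [show 3 + k - 1 = k + 2 by omega]; ring
  have h₂ : (3 + k) ^ 2 = k ^ 2 + 6 * k + 9 := by ring
  omega

theorem stmt_1 (S : Type*) [Fintype S] [SemilatticeInf S] [OrderBot S] [OrderTop S]
    (hn : 3 ≤ Fintype.card S) (m : ℕ) (hm : 1 ≤ m) :
    numInconsistent S m ≤
      (2 ^ m - 1) * (Fintype.card S ^ 2 - 3 * Fintype.card S + 3) := by
  have : IsEmpty {e : EqFst S m // ¬ e.HasSolution} := ⟨fun e => e.2 e.1.hasSolution⟩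
  let f : {e : EqSnd S m // ¬ e.HasSolution} →
      {T : Finset (Fin m) // T.Nonempty} × {p : S × S // ¬ p.2 ≤ p.1} :=
    fun e => (⟨e.1.T, e.1.hT⟩, ⟨(e.1.s₁, e.1.s₂), fun h => e.2 (EqSnd.hasSolution_of_le h)⟩)
  have hf : Function.Injective f := by
    rintro ⟨⟨T, hT, a, b⟩, h⟩ ⟨⟨T', hT', a', b'⟩, h'⟩ heq
    simp only [f, Prod.mk.injEq, Subtype.mk.injEq] at heq
    obtain ⟨rfl, rfl, rfl⟩ := heq
    rfl
  rw [numInconsistent, Nat.card_of_isEmpty, zero_add]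
  refine (Nat.card_le_card_of_injective f hf).trans ?_
  rw [Nat.card_prod, card_finset_nonempty]
  exact Nat.mul_le_mul_left _ (card_not_le_le hn)
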